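/- For the Hamming ball B_k = {x ∈ F_2^k : ∑ x_i ≤ 1} and any ε ∈ (0, 1/2), the ε-approximate spectral norm satisfies ‖1_{B_k}‖_{A,ε} ≤ 5 log₂(1/ε); i.e., there exists g : F_2^k → ℝ with ‖1_{B_k} − g‖_∞ ≤ ε and ‖g‖_A ≤ 5 log₂(1/ε). -/

import Mathlib

open Finset
open scoped Classical

noncomputable def chi {k : ℕ} (a x : Fin k → ZMod 2) : ℝ :=
  if ∑ i, a i * x i = (0 : ZMod 2) then 1 else -1

noncomputable def fhat {k : ℕ} (f : (Fin k → ZMod 2) → ℝ) (a : Fin k → ZMod 2) : ℝ :=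
  (∑ x, f x * chi a x) / 2 ^ k

noncomputable def specNorm {k : ℕ} (f : (Fin k → ZMod 2) → ℝ) : ℝ :=
  ∑ a, |fhat f a|

def hammingBall1 (k : ℕ) : Set (Fin k → ZMod 2) :=
  {x | (univ.filter fun i => x i ≠ 0).card ≤ 1}

noncomputable def ind {k : ℕ} (A : Set (Fin k → ZMod 2)) : (Fin k → ZMod 2) → ℝ :=
  fun x => if x ∈ A then 1 else 0

/-! ### The spectral norm of combinations of noise functions -/

/-- The Hamming weight of a vector over `ZMod 2`. -/
noncomputable def wt {k : ℕ} (x : Fin k → ZMod 2) : ℕ := (univ.filter fun i => x i ≠ 0).card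

/-- The nontrivial character of `ZMod 2`, with real values. -/
noncomputable def sgn (t : ZMod 2) : ℝ := if t = 0 then 1 else -1

lemma sgn_add (s t : ZMod 2) : sgn (s + t) = sgn s * sgn t := by
  have h : ∀ s t : ZMod 2, s + t = 0 ↔ (s = 0 ↔ t = 0) := by decide
  by_cases hs : s = 0 <;> by_cases ht : t = 0 <;> simp [sgn, h, hs, ht]

lemma sgn_sum {ι : Type*} (s : Finset ι) (f : ι → ZMod 2) :
    sgn (∑ i ∈ s, f i) = ∏ i ∈ s, sgn (f i) := by
  induction s using Finset.induction_on with
  | empty => simp [sgn]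
  | insert a s ha ih => rw [sum_insert ha, prod_insert ha, sgn_add, ih]

lemma chi_eq_prod {k : ℕ} (a x : Fin k → ZMod 2) : chi a x = ∏ i, sgn (a i * x i) := by
  rw [← sgn_sum]; rfl

lemma pow_wt_eq_prod {k : ℕ} (ρ : ℝ) (x : Fin k → ZMod 2) :
    ρ ^ wt x = ∏ i, if x i = 0 then 1 else ρ := by
  simp [wt, prod_ite]

lemma sum_prod_zmod_two {k : ℕ} (f : Fin k → ZMod 2 → ℝ) :
    ∑ x : Fin k → ZMod 2, ∏ i, f i (x i) = ∏ i, (f i 0 + f i 1) := by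
  rw [← Fintype.prod_sum]
  exact prod_congr rfl fun i _ => Fin.sum_univ_two (f i)

lemma fhat_pow_wt {k : ℕ} (ρ : ℝ) (a : Fin k → ZMod 2) :
    fhat (fun x => ρ ^ wt x) a = ∏ i, (1 + ρ * sgn (a i)) / 2 := by
  have h : ∑ x : Fin k → ZMod 2, ρ ^ wt x * chi a x = ∏ i, (1 + ρ * sgn (a i)) := by
    simp_rw [chi_eq_prod, pow_wt_eq_prod, ← prod_mul_distrib]
    rw [sum_prod_zmod_two fun i t => (if t = 0 then 1 else ρ) * sgn (a i * t)]
    simp [sgn]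
  rw [fhat, h, prod_div_distrib]
  simp

lemma specNorm_pow_wt {k : ℕ} {ρ : ℝ} (hρ : |ρ| ≤ 1) :
    specNorm (fun x : Fin k → ZMod 2 => ρ ^ wt x) = 1 := by
  obtain ⟨h1, h2⟩ := abs_le.mp hρ
  have hnn (a : Fin k → ZMod 2) : 0 ≤ ∏ i, (1 + ρ * sgn (a i)) / 2 := by
    refine prod_nonneg fun i _ => ?_
    rw [sgn]
    split_ifs <;> linarith
  simp_rw [specNorm, fhat_pow_wt, abs_of_nonneg (hnn _)]
  rw [sum_prod_zmod_two fun _ t => (1 + ρ * sgn t) / 2]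
  refine prod_eq_one fun i _ => ?_
  simp only [sgn, if_true, one_ne_zero, if_false]
  ring

lemma specNorm_add_le {k : ℕ} (f g : (Fin k → ZMod 2) → ℝ) :
    specNorm (fun x => f x + g x) ≤ specNorm f + specNorm g := by
  rw [specNorm, specNorm, specNorm, ← sum_add_distrib]
  refine sum_le_sum fun a _ => ?_
  have : fhat (fun x => f x + g x) a = fhat f a + fhat g a := by
    simp [fhat, add_mul, sum_add_distrib, add_div]
  rw [this]
  exact abs_add_le _ _

lemma specNorm_const_mul {k : ℕ} (c : ℝ) (f : (Fin k → ZMod 2) → ℝ) :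
    specNorm (fun x => c * f x) = |c| * specNorm f := by
  have (a : Fin k → ZMod 2) : fhat (fun x => c * f x) a = c * fhat f a := by
    simp [fhat, mul_assoc, ← mul_sum, mul_div_assoc]
  simp [specNorm, this, abs_mul, mul_sum]

lemma specNorm_sum_le {k : ℕ} {ι : Type*} (s : Finset ι) (f : ι → (Fin k → ZMod 2) → ℝ) :
    specNorm (fun x => ∑ i ∈ s, f i x) ≤ ∑ i ∈ s, specNorm (f i) := by
  induction s using Finset.induction_on with
  | empty => simp [specNorm, fhat]
  | insert a s ha ih =>
    simp_rw [sum_insert ha]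
    exact (specNorm_add_le _ _).trans (by gcongr)

/-! ### The derivative at the origin through values at the Chebyshev nodes -/

open Polynomial Polynomial.Chebyshev

lemma node_reflect {n i : ℕ} (hn : n ≠ 0) (hi : i ≤ n) : node n (n - i) = -node n i := by
  have hn' : (n : ℝ) ≠ 0 := by exact_mod_cast hn
  rw [node, node, ← Real.cos_pi_sub]
  congr 1
  push_cast [hi]
  field_simp

lemma node_ne_zero {n i : ℕ} (hn : Odd n) (hi : i ≤ n) : node n i ≠ 0 := by
  intro h
  have h1 : node n (n - i) = node n i := by rw [node_reflect hn.pos.ne' hi, h, neg_zero]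
  have h2 := (strictAntiOn_node n).injOn (x₁ := n - i) (x₂ := i) (by simp)
    (by simp; omega) h1
  obtain ⟨m, hm⟩ := hn
  omega

lemma derivative_nodal_node_eval_zero {n : ℕ} (hn : Odd n) :
    (derivative (Lagrange.nodal (range (n + 1)) (node n))).eval 0 = 0 := by
  have hsymm : (Lagrange.nodal (range (n + 1)) (node n)).comp (-X) =
      Lagrange.nodal (range (n + 1)) (node n) := by
    rw [Lagrange.nodal_eq, Polynomial.prod_comp, ← prod_range_reflect (fun i => X - C (node n i))]
    have (i) (hi : i ∈ range (n + 1)) : (X - C (node n i)).comp (-X) =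
        (-1) * (X - C (node n (n + 1 - 1 - i))) := by
      rw [Nat.add_sub_cancel, node_reflect hn.pos.ne' (by simp at hi; omega)]
      simp
      ring
    rw [prod_congr rfl this, prod_mul_distrib]
    simp [hn.add_one.neg_one_pow]
  have h := congrArg (fun p => (derivative p).eval 0) hsymm
  simp [derivative_comp] at h
  linarith

/-- The coefficients expressing the derivative at `0` through the values at Chebyshev nodes. -/
noncomputable def derivWeight (n i : ℕ) : ℝ :=
  (derivative (Lagrange.basis (range (n + 1)) (node n) i)).eval 0

lemma sum_derivWeight_mul_eval {n : ℕ} {P : ℝ[X]} (hP : P.degree ≤ n) :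
    ∑ i ∈ range (n + 1), derivWeight n i * P.eval (node n i) = (derivative P).eval 0 := by
  have hlt : P.degree < (range (n + 1)).card := by
    rw [card_range]
    exact hP.trans_lt (by exact_mod_cast Nat.lt_succ_self n)
  conv_rhs => rw [Lagrange.eq_interpolate (strictAntiOn_node n).injOn hlt]
  simp [Lagrange.interpolate_apply, derivWeight, eval_finsetSum, mul_comm]

lemma derivWeight_eq {n i : ℕ} (hn : Odd n) (hi : i ≤ n) :
    derivWeight n i = (∏ j ∈ (range (n + 1)).erase i, (node n i - node n j))⁻¹ *
      (-(Lagrange.nodal (range (n + 1)) (node n)).eval 0 / node n i ^ 2) := by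
  have hmem : i ∈ range (n + 1) := by simp; omega
  have hx := node_ne_zero hn hi
  set Q : ℝ[X] := Lagrange.nodal ((range (n + 1)).erase i) (node n)
  have hW : Lagrange.nodal (range (n + 1)) (node n) = (X - C (node n i)) * Q :=
    Lagrange.nodal_eq_mul_nodal_erase hmem
  have hb : Lagrange.basis (range (n + 1)) (node n) i =
      C (∏ j ∈ (range (n + 1)).erase i, (node n i - node n j))⁻¹ * Q := by
    simp only [Lagrange.basis, Lagrange.basisDivisor, prod_mul_distrib, Q, Lagrange.nodal_eq]
    rw [← prod_inv_distrib, map_prod]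
  have hd := derivative_nodal_node_eval_zero hn
  rw [hW] at hd ⊢
  rw [derivWeight, hb]
  simp at hd ⊢
  left
  field_simp
  linarith

lemma sum_abs_derivWeight_le {n : ℕ} (hn : Odd n) :
    ∑ i ∈ range (n + 1), |derivWeight n i| ≤ n := by
  set w := (Lagrange.nodal (range (n + 1)) (node n)).eval 0
  have habs (i) (hi : i ∈ range (n + 1)) : |derivWeight n i| * w =
      -|w| * (derivWeight n i * (T ℝ n).eval (node n i)) := by
    have hi' : i ≤ n := by simp at hi; omega
    rw [eval_T_real_node (by simpa using hi'), derivWeight_eq hn hi']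
    have hp := zero_lt_prod_node_sub_node hi'
    set p := ∏ j ∈ (range (n + 1)).erase i, (node n i - node n j)
    have hpabs : |p| = (-1) ^ i * p := by
      rw [← abs_of_pos hp, abs_mul, abs_neg_one_pow, one_mul]
    have hinv : |p⁻¹| = (-1) ^ i * p⁻¹ := by
      rw [abs_inv, hpabs, mul_inv, ← inv_pow, inv_neg_one]
    rw [abs_mul, hinv, abs_div, abs_neg, abs_of_nonneg (sq_nonneg (node n i))]
    ring
  have hw : w ≠ 0 := by
    refine Lagrange.eval_nodal_not_at_node fun i hi => ?_
    exact (node_ne_zero hn (by simp at hi; omega)).symm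
  have hsum := sum_congr rfl habs
  rw [← sum_mul, ← mul_sum, sum_derivWeight_mul_eval (by simp)] at hsum
  have hT : |(derivative (T ℝ n)).eval 0| ≤ n := by
    have hU := U_real_cos (Real.pi / 2) ((n : ℤ) - 1)
    rw [Real.cos_pi_div_two, Real.sin_pi_div_two, mul_one] at hU
    rw [T_derivative_eq_U]
    simp only [Int.cast_natCast, eval_mul, eval_natCast, abs_mul, Nat.abs_cast, hU]
    exact mul_le_of_le_one_right (by positivity) (Real.abs_sin_le_one _)
  have h := congrArg abs hsum
  rw [abs_mul, abs_mul, abs_neg, abs_abs, mul_comm |w|,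
    abs_of_nonneg (sum_nonneg fun i _ => abs_nonneg _)] at h
  exact (mul_right_cancel₀ (abs_ne_zero.mpr hw) h).trans_le hT

/-! ### The approximation -/

/-- The value on weight `w` of the approximation of the indicator of the Hamming ball. -/
noncomputable def ballApprox (n w : ℕ) : ℝ :=
  0 ^ w + ∑ i ∈ range (n + 1),
    (derivWeight n i * (node n i / 2) ^ w + -derivWeight n i * (-(node n i / 2)) ^ w)

lemma abs_node_le_one (n i : ℕ) : |node n i| ≤ 1 := Real.abs_cos_le_one _

lemma specNorm_ballApprox_le {k n : ℕ} (hn : Odd n) :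
    specNorm (fun x : Fin k → ZMod 2 => ballApprox n (wt x)) ≤ 1 + 2 * n := by
  have hhalf (i) : |node n i / 2| ≤ 1 := by
    have := abs_node_le_one n i
    rw [abs_div, abs_two]
    linarith
  have hterm (i) : specNorm (fun x : Fin k → ZMod 2 => derivWeight n i * (node n i / 2) ^ wt x +
      -derivWeight n i * (-(node n i / 2)) ^ wt x) ≤ 2 * |derivWeight n i| := by
    refine (specNorm_add_le _ _).trans_eq ?_
    rw [specNorm_const_mul, specNorm_const_mul, specNorm_pow_wt (hhalf i),
      specNorm_pow_wt (by rw [abs_neg]; exact hhalf i), abs_neg]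
    ring
  refine (specNorm_add_le _ _).trans ?_
  rw [specNorm_pow_wt (by simp)]
  grw [specNorm_sum_le, sum_le_sum fun i _ => hterm i, ← mul_sum, sum_abs_derivWeight_le hn]

lemma ballApprox_of_even {n w : ℕ} (hw : Even w) : ballApprox n w = 0 ^ w := by
  simp [ballApprox, hw.neg_pow]

lemma ballApprox_of_odd {n w : ℕ} (hw : Odd w) :
    ballApprox n w = 2 / 2 ^ w * ∑ i ∈ range (n + 1), derivWeight n i * node n i ^ w := by
  rw [ballApprox, zero_pow hw.pos.ne', zero_add, mul_sum]
  refine sum_congr rfl fun i _ => ?_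
  rw [hw.neg_pow, div_pow]
  ring

lemma sum_derivWeight_mul_pow {n w : ℕ} (hw : w ≤ n) :
    ∑ i ∈ range (n + 1), derivWeight n i * node n i ^ w = w * 0 ^ (w - 1) := by
  have h := sum_derivWeight_mul_eval (n := n) (P := X ^ w)
    ((degree_X_pow_le w).trans (by exact_mod_cast hw))
  simpa [derivative_X_pow] using h

lemma abs_sum_derivWeight_mul_pow_le {n : ℕ} (hn : Odd n) (w : ℕ) :
    |∑ i ∈ range (n + 1), derivWeight n i * node n i ^ w| ≤ n := by
  refine (abs_sum_le_sum_abs _ _).trans (le_trans (sum_le_sum fun i _ => ?_)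
    (sum_abs_derivWeight_le hn))
  rw [abs_mul, abs_pow]
  exact mul_le_of_le_one_right (abs_nonneg _) (pow_le_one₀ (abs_nonneg _) (abs_node_le_one n i))

lemma abs_sub_ballApprox_le {n : ℕ} (hn : Odd n) (w : ℕ) :
    |(if w ≤ 1 then 1 else 0) - ballApprox n w| ≤ n / 2 ^ (n + 1) := by
  have hpos : (0 : ℝ) ≤ n / 2 ^ (n + 1) := by positivity
  rcases Nat.even_or_odd w with hw | hw
  · rw [ballApprox_of_even hw]
    rcases Nat.eq_zero_or_pos w with rfl | hw0
    · simpa using hpos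
    · have : ¬ w ≤ 1 := by rintro h; obtain ⟨m, hm⟩ := hw; omega
      simpa [this, hw0.ne'] using hpos
  · rw [ballApprox_of_odd hw]
    by_cases hwn : w ≤ n
    · rw [sum_derivWeight_mul_pow hwn]
      by_cases h1 : w = 1
      · subst h1; simpa using hpos
      · have h2 : ¬ w ≤ 1 := by obtain ⟨m, hm⟩ := hw; omega
        have h3 : w - 1 ≠ 0 := by omega
        simpa [h2, h3] using hpos
    · have h2 : ¬ w ≤ 1 := by have := hn.pos; omega
      have h3 : n + 2 ≤ w := by
        obtain ⟨m, hm⟩ := hw; obtain ⟨l, hl⟩ := hn; omega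
      rw [if_neg h2, zero_sub, abs_neg, abs_mul, abs_of_nonneg (by positivity)]
      calc (2 : ℝ) / 2 ^ w * |∑ i ∈ range (n + 1), derivWeight n i * node n i ^ w|
          ≤ 2 / 2 ^ (n + 2) * n := by
            gcongr
            · norm_num
            · exact abs_sum_derivWeight_mul_pow_le hn w
        _ = n / 2 ^ (n + 1) := by rw [pow_succ (2 : ℝ) (n + 1)]; field_simp

/-! ### The choice of the degree -/

lemma pow_five_le_eight_pow (n : ℕ) : n ^ 5 ≤ 8 ^ n := by
  rcases Nat.lt_or_ge n 2 with h | h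
  · interval_cases n <;> norm_num
  · induction n, h using Nat.le_induction with
    | base => norm_num
    | succ n hn ih =>
      have h1 : (n + 1) ^ 5 ≤ 8 * n ^ 5 := by
        have h2 : 2 * (n + 1) ≤ 3 * n := by omega
        have h3 := Nat.pow_le_pow_left h2 5
        rw [mul_pow, mul_pow] at h3
        omega
      rw [pow_succ 8]
      omega

lemma exists_degree {ε : ℝ} (hε0 : 0 < ε) (hε : ε < 1 / 2) :
    ∃ n : ℕ, Odd n ∧ (n : ℝ) / 2 ^ (n + 1) ≤ ε ∧ 1 + 2 * (n : ℝ) ≤ 5 * Real.logb 2 (1 / ε) := by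
  have hex : ∃ s : ℕ, ((2 * s + 1 : ℕ) : ℝ) / 2 ^ (2 * s + 1 + 1) ≤ ε := by
    have hodd : Filter.Tendsto (fun s : ℕ => 2 * s + 1) Filter.atTop Filter.atTop :=
      Filter.tendsto_atTop_mono (fun s => by simp only [id]; omega) Filter.tendsto_id
    have hlim := (tendsto_pow_const_div_const_pow_of_one_lt 1 (one_lt_two (α := ℝ))).comp hodd
    obtain ⟨s, hs⟩ := (hlim.eventually_le_const hε0).exists
    refine ⟨s, le_trans ?_ hs⟩
    simp only [Function.comp_apply, pow_one]
    gcongr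
    · norm_num
    · omega
  refine ⟨2 * Nat.find hex + 1, ⟨_, rfl⟩, Nat.find_spec hex, ?_⟩
  rcases hs : Nat.find hex with _ | s
  · have : 1 ≤ Real.logb 2 (1 / ε) := by
      rw [Real.le_logb_iff_rpow_le (by norm_num) (by positivity), Real.rpow_one,
        le_div_iff₀ hε0]
      linarith
    norm_num
    norm_num at this
    linarith
  · have hlt := Nat.find_min hex (m := s) (by omega)
    rw [not_le, lt_div_iff₀ (by positivity)] at hlt
    set n := 2 * s + 1 with hn
    have hpow : (2 : ℝ) ^ (5 * (n + 1)) ≤ (1 / ε) ^ 5 * 2 ^ (3 * n) := by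
      have h1 : ((n : ℝ)) ^ 5 ≤ 2 ^ (3 * n) := by
        rw [pow_mul]
        exact_mod_cast pow_five_le_eight_pow n
      have h2 : (2 : ℝ) ^ (n + 1) ≤ 1 / ε * n := by
        rw [div_mul_eq_mul_div, one_mul, le_div_iff₀ hε0]
        linarith
      calc (2 : ℝ) ^ (5 * (n + 1)) = (2 ^ (n + 1)) ^ 5 := by rw [← pow_mul]; ring_nf
        _ ≤ (1 / ε * n) ^ 5 := by gcongr
        _ = (1 / ε) ^ 5 * n ^ 5 := mul_pow _ _ _
        _ ≤ _ := by gcongr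
    have h2 : (2 : ℝ) ^ (2 * n + 5) ≤ (1 / ε) ^ 5 := by
      have : (2 : ℝ) ^ (5 * (n + 1)) = 2 ^ (2 * n + 5) * 2 ^ (3 * n) := by
        rw [← pow_add]; ring_nf
      rw [this] at hpow
      exact le_of_mul_le_mul_right hpow (by positivity)
    have h3 := Real.logb_le_logb_of_le (b := 2) (by norm_num) (by positivity) h2
    rw [Real.logb_pow, Real.logb_pow, Real.logb_self_eq_one (by norm_num)] at h3
    push_cast [hn] at h3 ⊢
    linarith

theorem stmt8 (k : ℕ) (ε : ℝ) (hε0 : 0 < ε) (hε : ε < 1 / 2) :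
    ∃ g : (Fin k → ZMod 2) → ℝ,
      (∀ x, |ind (hammingBall1 k) x - g x| ≤ ε) ∧
      specNorm g ≤ 5 * Real.logb 2 (1 / ε) := by
  obtain ⟨n, hn, herr, hnorm⟩ := exists_degree hε0 hε
  refine ⟨fun x => ballApprox n (wt x), fun x => ?_, (specNorm_ballApprox_le hn).trans hnorm⟩
  have hind : ind (hammingBall1 k) x = if wt x ≤ 1 then 1 else 0 := by
    simp [ind, hammingBall1, wt]
  rw [hind]
  exact (abs_sub_ballApprox_le hn (wt x)).trans herr
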